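/- In the real quaternions ℍ, let σ = (1−√5)/2, τ = (1+√5)/2, ω = (1 + i + j + k)/2 and x = (i + σ·j + τ·k)/2. Then x⁴ = 1, ω⁶ = 1, i⁴ = j⁴ = k⁴ = 1, (x·i·ω)⁵ = 1, and (i·x·ω²)¹⁰ = 1. -/

import Mathlib

/-- A quaternion of norm one is a root of `X ^ 2 - 2 re(q) X + 1`. -/
theorem Quaternion.sq_eq_of_normSq_eq_one {q : Quaternion ℝ} (h : Quaternion.normSq q = 1) :
    q ^ 2 = (2 * q.re) • q - 1 := by
  have hs : star q = ((2 * q.re : ℝ) : Quaternion ℝ) - q := Quaternion.star_eq_two_re_sub q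
  have hm := Quaternion.self_mul_star q
  rw [hs, h, mul_sub, ← (Quaternion.coe_commutes (2 * q.re) q), Quaternion.coe_mul_eq_smul,
    Quaternion.coe_one] at hm
  rw [sq, ← hm]
  abel

/-- If `c ^ 2 + c = 1`, then a root of `X ^ 2 - c X + 1` is a fifth root of unity. -/
theorem pow_five_eq_one_of_sq_eq {A : Type*} [Ring A] [Algebra ℝ A] {q : A} {c : ℝ}
    (hc : c ^ 2 + c = 1) (hq : q ^ 2 = c • q - 1) : q ^ 5 = 1 := by
  rw [sq] at hq
  have h1 : c ^ 2 = 1 - c := by linarith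
  have h3 : q ^ 3 = -c • q - c • 1 := by
    rw [pow_succ, sq, hq, sub_mul, smul_mul_assoc, hq, one_mul]
    match_scalars <;> grind
  rw [show q ^ 5 = q ^ 3 * q * q by rw [← pow_succ, ← pow_succ], h3]
  simp only [sub_mul, smul_mul_assoc, one_mul, hq]
  match_scalars <;> grind

open Quaternion in
theorem stmt_19 :
    let i : ℍ[ℝ] := ⟨0, 1, 0, 0⟩
    let j : ℍ[ℝ] := ⟨0, 0, 1, 0⟩
    let k : ℍ[ℝ] := ⟨0, 0, 0, 1⟩
    let σ : ℝ := (1 - Real.sqrt 5) / 2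
    let τ : ℝ := (1 + Real.sqrt 5) / 2
    let ω : ℍ[ℝ] := (1 + i + j + k) / 2
    let x : ℍ[ℝ] := (i + (σ : ℍ[ℝ]) * j + (τ : ℍ[ℝ]) * k) / 2
    x ^ 4 = 1 ∧ ω ^ 6 = 1 ∧ i ^ 4 = 1 ∧ j ^ 4 = 1 ∧ k ^ 4 = 1 ∧
    (x * i * ω) ^ 5 = 1 ∧ (i * x * ω ^ 2) ^ 10 = 1 := by
  intro i j k σ τ ω x
  have hs : Real.sqrt 5 ^ 2 = 5 := Real.sq_sqrt (by norm_num)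
  have hστ : σ = 1 - τ := by simp only [σ, τ]; ring
  have hτ : τ ^ 2 = τ + 1 := by simp only [τ]; linear_combination hs / 4
  clear_value σ τ
  subst hστ
  have half (q : ℍ[ℝ]) : q / 2 = (2⁻¹ : ℝ) • q := by
    rw [show (2 : ℍ[ℝ]) = ((2 : ℝ) : ℍ[ℝ]) from rfl, div_eq_mul_inv, ← coe_inv,
      mul_coe_eq_smul]
  obtain ⟨hi₀, hi₁, hi₂, hi₃⟩ : i.re = 0 ∧ i.imI = 1 ∧ i.imJ = 0 ∧ i.imK = 0 :=
    ⟨rfl, rfl, rfl, rfl⟩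
  obtain ⟨hj₀, hj₁, hj₂, hj₃⟩ : j.re = 0 ∧ j.imI = 0 ∧ j.imJ = 1 ∧ j.imK = 0 :=
    ⟨rfl, rfl, rfl, rfl⟩
  obtain ⟨hk₀, hk₁, hk₂, hk₃⟩ : k.re = 0 ∧ k.imI = 0 ∧ k.imJ = 0 ∧ k.imK = 1 :=
    ⟨rfl, rfl, rfl, rfl⟩
  have hω : ω = (2⁻¹ : ℝ) • (1 + i + j + k) := half _
  have hx : x = (2⁻¹ : ℝ) • (i + ((1 - τ : ℝ) : ℍ[ℝ]) * j + (τ : ℍ[ℝ]) * k) := half _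
  clear_value i j k ω x
  obtain ⟨hω₀, hω₁, hω₂, hω₃⟩ :
      ω.re = 1 / 2 ∧ ω.imI = 1 / 2 ∧ ω.imJ = 1 / 2 ∧ ω.imK = 1 / 2 := by
    simp [*]
  obtain ⟨hx₀, hx₁, hx₂, hx₃⟩ :
      x.re = 0 ∧ x.imI = 1 / 2 ∧ x.imJ = (1 - τ) / 2 ∧ x.imK = τ / 2 := by
    rw [hx]
    simp only [coe_mul_eq_smul]
    simp [hi₀, hi₁, hi₂, hi₃, hj₀, hj₁, hj₂, hj₃, hk₀, hk₁, hk₂, hk₃, div_eq_inv_mul]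
  have pow_four {q : ℍ[ℝ]} (hr : q.re = 0) (hn : normSq q = 1) : q ^ 4 = 1 := by
    rw [show q ^ 4 = (q ^ 2) ^ 2 by rw [← pow_mul], sq_eq_of_normSq_eq_one hn, hr]
    simp
  have nx : normSq x = 1 := by
    rw [normSq_def', hx₀, hx₁, hx₂, hx₃]
    linear_combination hτ / 2
  have ni : normSq i = 1 := by simp [normSq_def', hi₀, hi₁, hi₂, hi₃]
  have nj : normSq j = 1 := by simp [normSq_def', hj₀, hj₁, hj₂, hj₃]
  have nk : normSq k = 1 := by simp [normSq_def', hk₀, hk₁, hk₂, hk₃]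
  have nω : normSq ω = 1 := by
    rw [normSq_def', hω₀, hω₁, hω₂, hω₃]
    norm_num
  have hω2 : ω ^ 2 = ω - 1 := by
    rw [sq_eq_of_normSq_eq_one nω, hω₀]
    norm_num
  refine ⟨pow_four hx₀ nx, ?_, pow_four hi₀ ni, pow_four hj₀ nj, pow_four hk₀ nk, ?_, ?_⟩
  · have h3 : ω ^ 3 = -1 := by
      rw [pow_succ, hω2, sub_mul, ← sq, hω2]
      simp
    rw [show ω ^ 6 = (ω ^ 3) ^ 2 by rw [← pow_mul], h3]
    simp
  · have hr : 2 * (x * i * ω).re = -τ := by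
      simp [hi₀, hi₁, hi₂, hi₃, hx₀, hx₁, hx₂, hx₃, hω₀, hω₁, hω₂, hω₃]
      ring
    refine pow_five_eq_one_of_sq_eq (c := -τ) (by linear_combination hτ) ?_
    rw [sq_eq_of_normSq_eq_one (by simp [nx, ni, nω]), hr]
  · have hr : 2 * (i * x * ω ^ 2).re = τ := by
      rw [hω2]
      simp [hi₀, hi₁, hi₂, hi₃, hx₀, hx₁, hx₂, hx₃, hω₀, hω₁, hω₂, hω₃]
      ring
    have hp := sq_eq_of_normSq_eq_one (q := i * x * ω ^ 2) (by simp [nx, ni, nω])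
    rw [hr] at hp
    have h5 : (-(i * x * ω ^ 2)) ^ 5 = 1 :=
      pow_five_eq_one_of_sq_eq (c := -τ) (by linear_combination hτ) (by rw [neg_sq, hp]; simp)
    rw [← Even.neg_pow (by decide : Even 10),
      show ∀ q : ℍ[ℝ], q ^ 10 = (q ^ 5) ^ 2 from fun q => pow_mul q 5 2, h5, one_pow]
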